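/- Second-order achievability for information reconciliation: let P_{XY} be a joint distribution on finite sets with V(X|Y)_P > 0 and 0 < ε < 1. There is a constant C such that for all sufficiently large n there exists an ε-correct one-way IR code on (P_{XY})^{×n} with log|M| ≤ n H(X|Y)_P + √(n V(X|Y)_P) · Φ^{-1}(1-ε) + (1/2) log n + C. -/

import Mathlib

open scoped BigOperators
noncomputable section

/-- Conditional entropy `H(X|Y)_P`. -/
def condH {X Y : Type*} [Fintype X] [Fintype Y] (P : X → Y → ℝ) : ℝ :=
  ∑ x, ∑ y, P x y * Real.log ((∑ x', P x' y) / P x y)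

/-- Conditional entropy variance `V(X|Y)_P`. -/
def condV {X Y : Type*} [Fintype X] [Fintype Y] (P : X → Y → ℝ) : ℝ :=
  ∑ x, ∑ y, P x y * (Real.log ((∑ x', P x' y) / P x y) - condH P)^2

/-- Standard normal cumulative distribution function. -/
def NPhi (x : ℝ) : ℝ := ∫ u in Set.Iic x, Real.exp (-u^2/2) / Real.sqrt (2*Real.pi)

/-- Inverse of the standard normal CDF. -/
def NPhiInv : ℝ → ℝ := Function.invFun NPhi

open MeasureTheory Filter Topology

/-- The standard normal density. -/
def normalDensity (x : ℝ) : ℝ := Real.exp (-x ^ 2 / 2) / Real.sqrt (2 * Real.pi)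

lemma normalDensity_pos (x : ℝ) : 0 < normalDensity x := by
  unfold normalDensity; positivity

lemma continuous_normalDensity : Continuous normalDensity := by
  unfold normalDensity; fun_prop

lemma normalDensity_neg (x : ℝ) : normalDensity (-x) = normalDensity x := by
  simp [normalDensity]

lemma normalDensity_eq_gaussianPDFReal :
    normalDensity = ProbabilityTheory.gaussianPDFReal 0 1 := by
  funext x
  simp [normalDensity, ProbabilityTheory.gaussianPDFReal]
  ring

lemma integrable_normalDensity : Integrable normalDensity := by
  rw [normalDensity_eq_gaussianPDFReal]
  exact ProbabilityTheory.integrable_gaussianPDFReal 0 1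

lemma integral_normalDensity : ∫ x, normalDensity x = 1 := by
  rw [normalDensity_eq_gaussianPDFReal]
  exact ProbabilityTheory.integral_gaussianPDFReal_eq_one 0 one_ne_zero

lemma hasDerivAt_normalDensity (x : ℝ) :
    HasDerivAt normalDensity (-(x * normalDensity x)) x := by
  have h1 : HasDerivAt (fun x : ℝ => -x ^ 2 / 2) (-x) x := by
    have := ((hasDerivAt_pow 2 x).neg).div_const 2
    refine this.congr_deriv ?_
    push_cast; ring
  have := (h1.exp).div_const (Real.sqrt (2 * Real.pi))
  refine this.congr_deriv ?_
  simp only [normalDensity]; ring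

lemma tendsto_normalDensity_atTop : Tendsto normalDensity atTop (𝓝 0) := by
  have h : Tendsto (fun x : ℝ => -x ^ 2 / 2) atTop atBot := by
    have h2 : Tendsto (fun x : ℝ => x ^ 2) atTop atTop := tendsto_pow_atTop two_ne_zero
    have := (tendsto_neg_atTop_atBot.comp h2).atBot_div_const (two_pos : (0 : ℝ) < 2)
    exact this
  have h3 := (Real.tendsto_exp_atBot.comp h).div_const (Real.sqrt (2 * Real.pi))
  rw [zero_div] at h3
  exact h3

/-- Mills ratio bound for the upper tail. -/
lemma mul_integral_Ioi_normalDensity_le {w : ℝ} (hw : 0 ≤ w) :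
    w * ∫ x in Set.Ioi w, normalDensity x ≤ normalDensity w := by
  have hd : ∀ x ∈ Set.Ici w, HasDerivAt (fun x => -normalDensity x) (x * normalDensity x) x :=
    fun x _ => (hasDerivAt_normalDensity x).neg.congr_deriv (neg_neg _)
  have hpos : ∀ x ∈ Set.Ioi w, 0 ≤ x * normalDensity x := fun x hx =>
    mul_nonneg (hw.trans (le_of_lt hx)) (normalDensity_pos x).le
  have ht : Tendsto (fun x => -normalDensity x) atTop (𝓝 0) := by
    simpa using tendsto_normalDensity_atTop.neg
  have hint := integrableOn_Ioi_deriv_of_nonneg' hd hpos ht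
  have hval := integral_Ioi_of_hasDerivAt_of_nonneg' hd hpos ht
  rw [← integral_const_mul]
  calc ∫ x in Set.Ioi w, w * normalDensity x
      ≤ ∫ x in Set.Ioi w, x * normalDensity x :=
        setIntegral_mono_on (integrable_normalDensity.integrableOn.const_mul w) hint
          measurableSet_Ioi fun x hx =>
            mul_le_mul_of_nonneg_right (le_of_lt hx) (normalDensity_pos x).le
    _ = normalDensity w := by rw [hval]; ring

/-- Mills ratio bound for the lower tail. -/
lemma neg_mul_integral_Iic_normalDensity_le {w : ℝ} (hw : w ≤ 0) :
    -w * ∫ x in Set.Iic w, normalDensity x ≤ normalDensity w := by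
  have h := mul_integral_Ioi_normalDensity_le (neg_nonneg.2 hw)
  rw [← integral_comp_neg_Iic] at h
  simpa only [normalDensity_neg] using h

lemma inv_normalDensity_le {w : ℝ} (hw : |w| ≤ 1) : 1 ≤ 9 * normalDensity w := by
  have h1 : w ^ 2 ≤ 1 := (sq_le_one_iff_abs_le_one w).2 hw
  have h2 : (1 : ℝ) / 2 ≤ Real.exp (-w ^ 2 / 2) := by
    have := Real.add_one_le_exp (-w ^ 2 / 2)
    linarith
  have h3 : Real.sqrt (2 * Real.pi) ≤ 3 := by
    rw [Real.sqrt_le_left (by norm_num)]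
    nlinarith [Real.pi_lt_d2]
  have h4 : 0 < Real.sqrt (2 * Real.pi) := by positivity
  unfold normalDensity
  rw [mul_div_assoc', le_div_iff₀ h4]
  linarith

/-- Bounded solutions of the Stein equation for a continuous test function with values in
`[0, 1]`. -/
lemma exists_stein_solution (h : ℝ → ℝ) (hc : Continuous h) (h0 : ∀ x, 0 ≤ h x)
    (h1 : ∀ x, h x ≤ 1) :
    ∃ f : ℝ → ℝ,
      (∀ w, HasDerivAt f (w * f w + h w - ∫ x, h x * normalDensity x) w) ∧
      (∀ w, |f w| ≤ 9) ∧ ∀ w, |w * f w| ≤ 1 := by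
  have hhi : Integrable fun x => h x * normalDensity x :=
    integrable_normalDensity.bdd_mul (c := 1) hc.aestronglyMeasurable
      (Eventually.of_forall fun x => by
        rw [Real.norm_eq_abs, abs_of_nonneg (h0 x)]; exact h1 x)
  set c := ∫ x, h x * normalDensity x with hcdef
  have hc0 : 0 ≤ c := integral_nonneg fun x => mul_nonneg (h0 x) (normalDensity_pos x).le
  have hc1 : c ≤ 1 := by
    rw [← integral_normalDensity]
    exact integral_mono hhi integrable_normalDensity fun x =>
      mul_le_of_le_one_left (normalDensity_pos x).le (h1 x)
  set ψ : ℝ → ℝ := fun x => (h x - c) * normalDensity x with hψ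
  have hψc : Continuous ψ := (hc.sub continuous_const).mul continuous_normalDensity
  have hψi : Integrable ψ := by
    have := hhi.sub (integrable_normalDensity.const_mul c)
    refine this.congr (Eventually.of_forall fun x => ?_)
    simp only [hψ, Pi.sub_apply]; ring
  have hψ0 : ∫ x, ψ x = 0 := by
    have : ∀ x, ψ x = h x * normalDensity x - c * normalDensity x := fun x => by
      simp only [hψ]; ring
    simp_rw [this]
    rw [integral_sub hhi (integrable_normalDensity.const_mul c), integral_const_mul,
      integral_normalDensity, ← hcdef]
    ring
  have hψle : ∀ x, ‖ψ x‖ ≤ normalDensity x := fun x => by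
    rw [Real.norm_eq_abs, hψ, abs_mul, abs_of_pos (normalDensity_pos x)]
    refine mul_le_of_le_one_left (normalDensity_pos x).le (abs_le.2 ⟨?_, ?_⟩)
    · linarith [h0 x]
    · linarith [h1 x]
  set F : ℝ → ℝ := fun w => ∫ x in Set.Iic w, ψ x with hF
  have hFd : ∀ w, HasDerivAt F (ψ w) w := fun w => by
    have hd := (hψc.integral_hasStrictDerivAt 0 w).hasDerivAt.const_add (∫ x in Set.Iic 0, ψ x)
    refine hd.congr_of_eventuallyEq (Eventually.of_forall fun u => ?_)
    have := intervalIntegral.integral_Iic_sub_Iic (f := ψ) (μ := volume) (a := 0) (b := u)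
      hψi.integrableOn hψi.integrableOn
    simp only [hF]; linarith
  have hFl : ∀ w, |F w| ≤ ∫ x in Set.Iic w, normalDensity x := fun w =>
    norm_integral_le_of_norm_le integrable_normalDensity.integrableOn
      (Eventually.of_forall hψle)
  have hFr : ∀ w, |F w| ≤ ∫ x in Set.Ioi w, normalDensity x := fun w => by
    have h2 := intervalIntegral.integral_Iic_add_Ioi (f := ψ) (μ := volume) (b := w)
      hψi.integrableOn hψi.integrableOn
    have h3 : F w = -∫ x in Set.Ioi w, ψ x := by simp only [hF]; linarith
    rw [h3, abs_neg]
    exact norm_integral_le_of_norm_le integrable_normalDensity.integrableOn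
      (Eventually.of_forall hψle)
  have hF1 : ∀ w, |F w| ≤ 1 := fun w => by
    refine (hFl w).trans ?_
    rw [← integral_normalDensity]
    exact setIntegral_le_integral integrable_normalDensity
      (Eventually.of_forall fun x => (normalDensity_pos x).le)
  have hFm : ∀ w, |w| * |F w| ≤ normalDensity w := fun w => by
    rcases le_total 0 w with hw | hw
    · rw [abs_of_nonneg hw]
      exact (mul_le_mul_of_nonneg_left (hFr w) hw).trans (mul_integral_Ioi_normalDensity_le hw)
    · rw [abs_of_nonpos hw]
      exact (mul_le_mul_of_nonneg_left (hFl w) (neg_nonneg.2 hw)).trans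
        (neg_mul_integral_Iic_normalDensity_le hw)
  refine ⟨fun w => F w / normalDensity w, fun w => ?_, fun w => ?_, fun w => ?_⟩
  · have hp := (normalDensity_pos w).ne'
    refine ((hFd w).div (hasDerivAt_normalDensity w) hp).congr_deriv ?_
    simp only [hψ]
    field_simp
    ring
  · rw [abs_div, abs_of_pos (normalDensity_pos w), div_le_iff₀ (normalDensity_pos w)]
    rcases le_total |w| 1 with hw | hw
    · exact (hF1 w).trans (inv_normalDensity_le hw)
    · have := hFm w
      nlinarith [abs_nonneg (F w), normalDensity_pos w]
  · rw [mul_div_assoc', abs_div, abs_of_pos (normalDensity_pos w),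
      div_le_one (normalDensity_pos w), abs_mul]
    exact hFm w

/-- The modulus of continuity of `w ↦ w * f w` for a Stein solution `f`. -/
lemma abs_mul_sub_mul_le_of_stein {f h : ℝ → ℝ} {c : ℝ}
    (hf : ∀ w, HasDerivAt f (w * f w + h w - c) w) (hf9 : ∀ w, |f w| ≤ 9)
    (hf1 : ∀ w, |w * f w| ≤ 1) (hhc : ∀ w, |h w - c| ≤ 1) {x y δ : ℝ} (hxy : |x - y| ≤ δ) :
    |x * f x - y * f y| ≤ (9 + 2 * (|y| + δ)) * δ := by
  have hδ : 0 ≤ δ := (abs_nonneg _).trans hxy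
  have hd : ∀ w, HasDerivAt (fun w => w * f w) (f w + w * (w * f w + h w - c)) w := fun w =>
    ((hasDerivAt_id w).mul (hf w)).congr_deriv (by simp)
  have hb : ∀ w ∈ Metric.closedBall y δ, ‖f w + w * (w * f w + h w - c)‖ ≤
      9 + 2 * (|y| + δ) := fun w hw => by
    have hw' : |w| ≤ |y| + δ := by
      have h1 : |w - y| ≤ δ := by simpa [Real.dist_eq] using hw
      have h2 := abs_add_le (w - y) y
      simp only [sub_add_cancel] at h2
      linarith
    have h2 : |w * f w + h w - c| ≤ 2 := by
      rw [add_sub_assoc]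
      linarith [abs_add_le (w * f w) (h w - c), hf1 w, hhc w]
    have h3 : |w * (w * f w + h w - c)| ≤ (|y| + δ) * 2 := by
      rw [abs_mul]; gcongr
    rw [Real.norm_eq_abs]
    linarith [abs_add_le (f w) (w * (w * f w + h w - c)), hf9 w]
  have := (convex_closedBall y δ).norm_image_sub_le_of_norm_hasDerivWithin_le
    (fun w _ => (hd w).hasDerivWithinAt) hb (Metric.mem_closedBall_self hδ)
    (show x ∈ Metric.closedBall y δ by simpa [Real.dist_eq] using hxy)
  rw [Real.norm_eq_abs, Real.norm_eq_abs] at this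
  exact this.trans (mul_le_mul_of_nonneg_left hxy (by positivity))

/-- The expectation of `F` under the `n`-fold product of the weights `p`. -/
def iidMean {Ω : Type*} [Fintype Ω] (p : Ω → ℝ) (n : ℕ) (F : (Fin n → Ω) → ℝ) : ℝ :=
  ∑ ω, (∏ i, p (ω i)) * F ω

section iidMean

variable {Ω : Type*} [Fintype Ω] {p : Ω → ℝ} {n : ℕ}

lemma iidMean_add (F G : (Fin n → Ω) → ℝ) :
    iidMean p n (fun ω => F ω + G ω) = iidMean p n F + iidMean p n G := by
  simp [iidMean, mul_add, Finset.sum_add_distrib]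

lemma iidMean_const_mul (c : ℝ) (F : (Fin n → Ω) → ℝ) :
    iidMean p n (fun ω => c * F ω) = c * iidMean p n F := by
  simp only [iidMean, Finset.mul_sum]
  exact Finset.sum_congr rfl fun _ _ => by ring

lemma iidMean_sum {ι : Type*} (s : Finset ι) (F : ι → (Fin n → Ω) → ℝ) :
    iidMean p n (fun ω => ∑ i ∈ s, F i ω) = ∑ i ∈ s, iidMean p n (F i) := by
  simp only [iidMean, Finset.mul_sum]
  exact Finset.sum_comm

lemma iidMean_const (hp1 : ∑ a, p a = 1) (c : ℝ) : iidMean p n (fun _ => c) = c := by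
  classical
  have h := Finset.prod_univ_sum (fun _ : Fin n => (Finset.univ : Finset Ω)) (fun _ a => p a)
  rw [Fintype.piFinset_univ] at h
  rw [iidMean, ← Finset.sum_mul, ← h]
  simp [hp1]

lemma iidMean_mono (hp : ∀ a, 0 ≤ p a) {F G : (Fin n → Ω) → ℝ} (h : ∀ ω, F ω ≤ G ω) :
    iidMean p n F ≤ iidMean p n G :=
  Finset.sum_le_sum fun ω _ =>
    mul_le_mul_of_nonneg_left (h ω) (Finset.prod_nonneg fun i _ => hp (ω i))

lemma iidMean_succ (i : Fin (n + 1)) (F : (Fin (n + 1) → Ω) → ℝ) :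
    iidMean p (n + 1) F = ∑ a, p a * iidMean p n (fun ω => F (i.insertNth a ω)) := by
  rw [iidMean, ← (Fin.insertNthEquiv (fun _ : Fin (n + 1) => Ω) i).sum_comp,
    Fintype.sum_prod_type]
  refine Finset.sum_congr rfl fun a _ => ?_
  rw [iidMean, Finset.mul_sum]
  refine Finset.sum_congr rfl fun ω _ => ?_
  change (∏ j, p ((i.insertNth a ω : Fin (n + 1) → Ω) j)) * F (i.insertNth a ω) = _
  simp only [Fin.prod_univ_succAbove _ i, Fin.insertNth_apply_same,
    Fin.insertNth_apply_succAbove]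
  ring

/-- Independent centred summands have additive variance. -/
lemma iidMean_sq_sum (hp1 : ∑ a, p a = 1) {ξ : Ω → ℝ} (hξ : ∑ a, p a * ξ a = 0) (n : ℕ) :
    iidMean p n (fun ω => (∑ i, ξ (ω i)) ^ 2) = n * ∑ a, p a * ξ a ^ 2 := by
  induction n with
  | zero => simp [iidMean]
  | succ n ih =>
    rw [iidMean_succ 0]
    have h : ∀ a, iidMean p n (fun ω => (∑ i, ξ ((Fin.insertNth 0 a ω : Fin (n + 1) → Ω) i)) ^ 2)
        = ξ a ^ 2 + (2 * ξ a) * iidMean p n (fun ω => ∑ i, ξ (ω i))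
          + n * ∑ a, p a * ξ a ^ 2 := fun a => by
      rw [← ih, ← iidMean_const_mul, ← iidMean_const (n := n) hp1 (ξ a ^ 2), ← iidMean_add,
        ← iidMean_add]
      congr 1
      funext ω
      rw [Fin.sum_univ_succAbove _ 0]
      simp only [Fin.insertNth_apply_same, Fin.insertNth_apply_succAbove]
      ring
    simp_rw [h, mul_add, Finset.sum_add_distrib, ← Finset.sum_mul, hp1]
    have h2 : ∑ a, p a * (2 * ξ a * iidMean p n (fun ω => ∑ i, ξ (ω i))) = 0 := by
      have : ∀ a, p a * (2 * ξ a * iidMean p n (fun ω => ∑ i, ξ (ω i))) =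
          (p a * ξ a) * (2 * iidMean p n (fun ω => ∑ i, ξ (ω i))) := fun a => by ring
      simp_rw [this, ← Finset.sum_mul, hξ, zero_mul]
    rw [h2]
    push_cast
    ring

lemma iidMean_sum_mul (ξ : Ω → ℝ) (F : ℝ → ℝ) :
    iidMean p (n + 1) (fun ω => (∑ i, ξ (ω i)) * F (∑ i, ξ (ω i))) =
      (n + 1) * ∑ a, p a * (ξ a * iidMean p n (fun ω => F (ξ a + ∑ i, ξ (ω i)))) := by
  simp_rw [Finset.sum_mul]
  rw [iidMean_sum]
  have h : ∀ i : Fin (n + 1), iidMean p (n + 1) (fun ω => ξ (ω i) * F (∑ j, ξ (ω j))) =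
      ∑ a, p a * (ξ a * iidMean p n (fun ω => F (ξ a + ∑ i, ξ (ω i)))) := fun i => by
    rw [iidMean_succ i]
    refine Finset.sum_congr rfl fun a _ => ?_
    rw [← iidMean_const_mul (ξ a)]
    simp only [Fin.insertNth_apply_same, Fin.sum_univ_succAbove _ i,
      Fin.insertNth_apply_succAbove]
  simp [h]

/-- Symmetrization of the covariance of `ξ` and `G` for a centred `ξ`. -/
lemma sum_mul_eq_half_sum_sub_mul_sub (hp1 : ∑ a, p a = 1) {ξ : Ω → ℝ}
    (hξ : ∑ a, p a * ξ a = 0) (G : Ω → ℝ) :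
    ∑ a, p a * (ξ a * G a) =
      1 / 2 * ∑ a, ∑ b, p a * p b * ((ξ a - ξ b) * (G a - G b)) := by
  have h : ∀ a b, p a * p b * ((ξ a - ξ b) * (G a - G b)) =
      (p a * (ξ a * G a)) * p b - (p a * ξ a) * (p b * G b) - (p a * G a) * (p b * ξ b)
        + p a * (p b * (ξ b * G b)) := fun a b => by ring
  simp_rw [h, Finset.sum_add_distrib, Finset.sum_sub_distrib, ← Finset.mul_sum,
    ← Finset.sum_mul, hp1, hξ]
  ring

end iidMean

/-- A continuous ramp descending from `1` at `z` to `0` at `z + δ`. -/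
lemma exists_ramp (z : ℝ) {δ : ℝ} (hδ : 0 < δ) :
    ∃ h : ℝ → ℝ, Continuous h ∧ (∀ x, 0 ≤ h x) ∧ (∀ x, h x ≤ 1) ∧ (∀ x ≤ z, h x = 1) ∧
      ∀ x, z + δ ≤ x → h x = 0 := by
  refine ⟨fun x => max 0 (min 1 ((z + δ - x) / δ)), by fun_prop, fun x => le_max_left _ _,
    fun x => max_le zero_le_one (min_le_left _ _), fun x hx => ?_, fun x hx => ?_⟩
  · have : 1 ≤ (z + δ - x) / δ := by rw [le_div_iff₀ hδ]; linarith
    simp [min_eq_left this]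
  · have : (z + δ - x) / δ ≤ 0 := div_nonpos_of_nonpos_of_nonneg (by linarith) hδ.le
    exact max_eq_left ((min_le_right _ _).trans this)

lemma NPhi_le_integral_mul {h : ℝ → ℝ} {z : ℝ} (hc : Continuous h) (h0 : ∀ x, 0 ≤ h x)
    (h1 : ∀ x, h x ≤ 1) (hz : ∀ x ≤ z, h x = 1) :
    NPhi z ≤ ∫ x, h x * normalDensity x := by
  have hhi : Integrable fun x => h x * normalDensity x :=
    integrable_normalDensity.bdd_mul (c := 1) hc.aestronglyMeasurable
      (Eventually.of_forall fun x => by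
        rw [Real.norm_eq_abs, abs_of_nonneg (h0 x)]; exact h1 x)
  have h2 : NPhi z = ∫ x in Set.Iic z, h x * normalDensity x :=
    setIntegral_congr_fun measurableSet_Iic fun x hx => by
      simp only [hz x hx, one_mul, normalDensity]
  rw [h2]
  exact setIntegral_le_integral hhi
    (Eventually.of_forall fun x => mul_nonneg (h0 x) (normalDensity_pos x).le)

lemma abs_le_one_add_sq (x : ℝ) : |x| ≤ 1 + x ^ 2 := by
  nlinarith [sq_nonneg (|x| - 1), sq_abs x, abs_nonneg x]

/-- One-sided Berry–Esseen bound for bounded summands with finitely many values. -/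
lemma NPhi_le_iidMean_add {Ω : Type*} [Fintype Ω] {p : Ω → ℝ} (hp : ∀ a, 0 ≤ p a)
    (hp1 : ∑ a, p a = 1) {ξ : Ω → ℝ} (hξ : ∑ a, p a * ξ a = 0) {v : ℝ} (hv : 0 < v)
    (hξv : ∑ a, p a * ξ a ^ 2 = v) {B : ℝ} (hB : 0 < B) (hξB : ∀ a, |ξ a| ≤ B)
    (n : ℕ) (z : ℝ) {s δ : ℝ} (hs : s = Real.sqrt ((n + 1) * v)) (hδ : δ = B / s) :
    NPhi z ≤ iidMean p (n + 1)
        (fun ω => if ∑ i, ξ (ω i) ≤ s * z + 3 * B then 1 else 0)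
      + 2 * ((13 + 2 * δ) * δ) := by
  have hs0 : 0 < s := by rw [hs]; positivity
  have hs2 : s ^ 2 = (n + 1) * v := by rw [hs]; exact Real.sq_sqrt (by positivity)
  have hδ0 : 0 < δ := by rw [hδ]; positivity
  obtain ⟨h, hc, h0, h1, hz, hzδ⟩ := exists_ramp z hδ0
  obtain ⟨f, hf, hf9, hf1⟩ := exists_stein_solution h hc h0 h1
  have hΦ := NPhi_le_integral_mul hc h0 h1 hz
  set c := ∫ x, h x * normalDensity x with hcdef
  have hc0 : 0 ≤ c := integral_nonneg fun x => mul_nonneg (h0 x) (normalDensity_pos x).le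
  have hc1 : c ≤ 1 := by
    rw [← integral_normalDensity]
    refine integral_mono_of_nonneg
      (Eventually.of_forall fun x => mul_nonneg (h0 x) (normalDensity_pos x).le)
      integrable_normalDensity (Eventually.of_forall fun x =>
      mul_le_of_le_one_left (normalDensity_pos x).le (h1 x))
  have hhc : ∀ w, |h w - c| ≤ 1 := fun w =>
    abs_le.2 ⟨by linarith [h0 w], by linarith [h1 w]⟩
  set g : ℝ → ℝ := fun w => w * f w with hg
  -- the sum of the remaining `n` terms, normalized
  set W : (Fin n → Ω) → ℝ := fun ω => (∑ i, ξ (ω i)) / s with hW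
  set R : (Fin n → Ω) → ℝ := fun ω => (9 + 2 * (|W ω| + δ)) * δ with hR
  set T : (Fin n → Ω) → ℝ := fun ω => if W ω ≤ z + 2 * δ then 1 else 0 with hT
  have hgW : ∀ ω x, |x - W ω| ≤ δ → |g x - g (W ω)| ≤ R ω := fun ω x hx =>
    abs_mul_sub_mul_le_of_stein hf hf9 hf1 hhc hx
  have hclose : ∀ ω t, |t| ≤ B → |(t + ∑ i, ξ (ω i)) / s - W ω| ≤ δ := fun ω t ht => by
    have : (t + ∑ i, ξ (ω i)) / s - W ω = t / s := by simp only [hW]; ring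
    rw [this, abs_div, abs_of_pos hs0, hδ]
    gcongr
  have hRmean : iidMean p n R ≤ (13 + 2 * δ) * δ := by
    have hle : ∀ ω, R ω ≤ (11 + 2 * δ) * δ + (2 * δ / s ^ 2) * (∑ i, ξ (ω i)) ^ 2 := fun ω => by
      have h2 := abs_le_one_add_sq (W ω)
      have h3 : (2 * δ / s ^ 2) * (∑ i, ξ (ω i)) ^ 2 = 2 * δ * W ω ^ 2 := by
        simp only [hW]; field_simp
      rw [h3]
      simp only [hR]
      nlinarith
    refine (iidMean_mono hp hle).trans ?_
    rw [iidMean_add, iidMean_const hp1, iidMean_const_mul, iidMean_sq_sum hp1 hξ, hξv, hs2]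
    have : 2 * δ / ((n + 1) * v) * (n * v) ≤ 2 * δ := by
      rw [div_mul_eq_mul_div, div_le_iff₀ (by positivity)]
      nlinarith [mul_pos hδ0 hv]
    linarith
  have hTmean : iidMean p n T ≤ iidMean p (n + 1)
        (fun ω => if ∑ i, ξ (ω i) ≤ s * z + 3 * B then 1 else 0) := by
    rw [iidMean_succ 0]
    have : iidMean p n T = ∑ a, p a * iidMean p n T := by rw [← Finset.sum_mul, hp1, one_mul]
    rw [this]
    refine Finset.sum_le_sum fun a _ => mul_le_mul_of_nonneg_left
      (iidMean_mono hp fun ω => ?_) (hp a)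
    simp only [hT, Fin.sum_univ_succAbove _ 0, Fin.insertNth_apply_same,
      Fin.insertNth_apply_succAbove]
    by_cases hw : W ω ≤ z + 2 * δ
    · have h2 : ∑ i, ξ (ω i) ≤ s * z + 2 * B := by
        simp only [hW, div_le_iff₀ hs0] at hw
        have h3 : δ * s = B := by rw [hδ]; field_simp
        nlinarith
      have h3 := (abs_le.1 (hξB a)).2
      rw [if_pos hw, if_pos (by linarith)]
    · rw [if_neg hw]
      split_ifs <;> norm_num
  -- the mean of `g` at the full sum, in two ways
  set E := iidMean p (n + 1) (fun ω => g ((∑ i, ξ (ω i)) / s)) with hE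
  have hlow : iidMean p n (fun ω => g (W ω)) - iidMean p n R ≤ E := by
    have hsub : iidMean p n (fun ω => g (W ω)) - iidMean p n R =
        iidMean p n (fun ω => g (W ω) + (-1) * R ω) := by
      rw [iidMean_add, iidMean_const_mul]; ring
    rw [hE, iidMean_succ 0, hsub]
    have : iidMean p n (fun ω => g (W ω) + (-1) * R ω) =
      ∑ a, p a * iidMean p n (fun ω => g (W ω) + (-1) * R ω) := by
        rw [← Finset.sum_mul, hp1, one_mul]
    rw [this]
    refine Finset.sum_le_sum fun a _ => mul_le_mul_of_nonneg_left
      (iidMean_mono hp fun ω => ?_) (hp a)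
    simp only [Fin.sum_univ_succAbove _ 0, Fin.insertNth_apply_same,
      Fin.insertNth_apply_succAbove]
    have := (abs_le.1 (hgW ω _ (hclose ω _ (hξB a)))).1
    linarith
  have hup : E ≤ iidMean p n (fun ω => g (W ω)) + iidMean p n R + iidMean p n T - c := by
    have hE2 : E = (n + 1) / s * ∑ a, p a *
        (ξ a * iidMean p n (fun ω => f ((ξ a + ∑ i, ξ (ω i)) / s))) := by
      have := iidMean_sum_mul (p := p) (n := n) ξ (fun t => f (t / s))
      rw [div_mul_eq_mul_div, ← this, eq_div_iff hs0.ne', mul_comm, hE, ← iidMean_const_mul]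
      congr 1
      funext ω
      simp only [hg]
      field_simp
    set U := iidMean p n (fun ω => g (W ω) + R ω + T ω + -c) with hU
    have hUeq : U = iidMean p n (fun ω => g (W ω)) + iidMean p n R + iidMean p n T - c := by
      rw [hU, iidMean_add, iidMean_add, iidMean_add, iidMean_const hp1]; ring
    have hpt : ∀ a b ω, (ξ a - ξ b) *
        (f ((ξ a + ∑ i, ξ (ω i)) / s) - f ((ξ b + ∑ i, ξ (ω i)) / s)) ≤
        (ξ a - ξ b) ^ 2 / s * (g (W ω) + R ω + T ω + -c) := by
      intro a b ω
      have key : ∀ a b, ξ b < ξ a → (ξ a - ξ b) *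
          (f ((ξ a + ∑ i, ξ (ω i)) / s) - f ((ξ b + ∑ i, ξ (ω i)) / s)) ≤
          (ξ a - ξ b) ^ 2 / s * (g (W ω) + R ω + T ω + -c) := by
        intro a b hab
        have hlt : (ξ b + ∑ i, ξ (ω i)) / s < (ξ a + ∑ i, ξ (ω i)) / s := by gcongr
        obtain ⟨y, ⟨hy1, hy2⟩, hy⟩ := exists_hasDerivAt_eq_slope f _ hlt
          (fun x _ => (hf x).continuousAt.continuousWithinAt) (fun x _ => hf x)
        have hyW : |y - W ω| ≤ δ := by
          have h2 := abs_le.1 (hclose ω _ (hξB a))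
          have h3 := abs_le.1 (hclose ω _ (hξB b))
          exact abs_le.2 ⟨by linarith, by linarith⟩
        have hgy := (abs_le.1 (hgW ω y hyW)).2
        have hhy : h y ≤ T ω := by
          simp only [hT]
          split_ifs with hw
          · exact h1 y
          · refine (hzδ y ?_).le
            have := (abs_le.1 hyW).1
            linarith
        rw [eq_div_iff (sub_pos.2 hlt).ne'] at hy
        rw [← hy]
        have h4 : (ξ a + ∑ i, ξ (ω i)) / s - (ξ b + ∑ i, ξ (ω i)) / s = (ξ a - ξ b) / s := by
          ring
        rw [h4]
        have h5 : (ξ a - ξ b) * ((y * f y + h y - c) * ((ξ a - ξ b) / s)) =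
          (ξ a - ξ b) ^ 2 / s * (y * f y + h y - c) := by ring
        rw [h5]
        refine mul_le_mul_of_nonneg_left ?_ (by positivity)
        change g y - g (W ω) ≤ R ω at hgy
        change g y + h y - c ≤ _
        linarith
      rcases lt_trichotomy (ξ a) (ξ b) with hab | hab | hab
      · have := key b a hab
        calc _ = (ξ b - ξ a) *
          (f ((ξ b + ∑ i, ξ (ω i)) / s) - f ((ξ a + ∑ i, ξ (ω i)) / s)) := by ring
          _ ≤ _ := this
          _ = _ := by ring
      · simp [hab]
      · exact key a b hab
    have hvar : ∑ a, ∑ b, p a * p b * (ξ a - ξ b) ^ 2 = 2 * v := by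
      have := sum_mul_eq_half_sum_sub_mul_sub hp1 hξ ξ
      simp only [← sq] at this
      rw [hξv] at this
      linarith
    rw [← hUeq, hE2, sum_mul_eq_half_sum_sub_mul_sub hp1 hξ]
    calc _ ≤ (n + 1) / s * (1 / 2 * ∑ a, ∑ b, p a * p b * ((ξ a - ξ b) ^ 2 / s * U)) := by
          have : 0 ≤ (n + 1) / s := by positivity
          refine mul_le_mul_of_nonneg_left (mul_le_mul_of_nonneg_left
            (Finset.sum_le_sum fun a _ => Finset.sum_le_sum fun b _ =>
              mul_le_mul_of_nonneg_left ?_ (mul_nonneg (hp a) (hp b))) (by norm_num)) this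
          have h2 : iidMean p n (fun ω => f ((ξ a + ∑ i, ξ (ω i)) / s)) -
              iidMean p n (fun ω => f ((ξ b + ∑ i, ξ (ω i)) / s)) =
              iidMean p n (fun ω => f ((ξ a + ∑ i, ξ (ω i)) / s) +
                (-1) * f ((ξ b + ∑ i, ξ (ω i)) / s)) := by
            rw [iidMean_add, iidMean_const_mul]; ring
          rw [h2, hU, ← iidMean_const_mul, ← iidMean_const_mul]
          refine iidMean_mono hp fun ω => ?_
          have := hpt a b ω
          linarith
      _ = (n + 1) / s * (1 / 2 * ((∑ a, ∑ b, p a * p b * (ξ a - ξ b) ^ 2) * (U / s))) := by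
          congr 2
          simp only [Finset.sum_mul]
          refine Finset.sum_congr rfl fun a _ => Finset.sum_congr rfl fun b _ => by ring
      _ = ((n + 1) * v / s ^ 2) * U := by rw [hvar]; field_simp
      _ = U := by rw [hs2, div_self (by positivity), one_mul]
  linarith

lemma hasDerivAt_NPhi (x : ℝ) : HasDerivAt NPhi (normalDensity x) x := by
  have hd := (continuous_normalDensity.integral_hasStrictDerivAt 0 x).hasDerivAt.const_add
    (∫ u in Set.Iic 0, normalDensity u)
  refine hd.congr_of_eventuallyEq (Eventually.of_forall fun u => ?_)
  have := intervalIntegral.integral_Iic_sub_Iic (f := normalDensity) (μ := volume) (a := 0)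
    (b := u) integrable_normalDensity.integrableOn integrable_normalDensity.integrableOn
  change ∫ x in Set.Iic u, normalDensity x = _
  linarith

lemma NPhi_eq_cdf : NPhi = ProbabilityTheory.cdf (ProbabilityTheory.gaussianReal 0 1) := by
  funext x
  rw [ProbabilityTheory.cdf_eq_real, measureReal_def,
    ProbabilityTheory.gaussianReal_apply_eq_integral 0 one_ne_zero, ENNReal.toReal_ofReal,
    ← normalDensity_eq_gaussianPDFReal]
  · rfl
  · exact integral_nonneg fun x => ProbabilityTheory.gaussianPDFReal_nonneg 0 1 x

lemma NPhi_NPhiInv {q : ℝ} (h0 : 0 < q) (h1 : q < 1) : NPhi (NPhiInv q) = q := by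
  have hcont : Continuous NPhi :=
    continuous_iff_continuousAt.2 fun x => (hasDerivAt_NPhi x).continuousAt
  have hbot : Tendsto NPhi atBot (𝓝 0) := by
    rw [NPhi_eq_cdf]; exact ProbabilityTheory.tendsto_cdf_atBot _
  have htop : Tendsto NPhi atTop (𝓝 1) := by
    rw [NPhi_eq_cdf]; exact ProbabilityTheory.tendsto_cdf_atTop _
  exact Function.invFun_eq (mem_range_of_exists_le_of_exists_ge hcont
    ((hbot.eventually_le_const h0).exists) ((htop.eventually_const_le h1).exists))

lemma exists_mul_le_NPhi_sub (z : ℝ) :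
    ∃ κ > 0, ∀ η, 0 ≤ η → η ≤ 1 → NPhi z + κ * η ≤ NPhi (z + η) := by
  refine ⟨normalDensity (|z| + 1), normalDensity_pos _, fun η h0 h1 => ?_⟩
  rcases h0.eq_or_lt with rfl | h0
  · simp
  obtain ⟨y, ⟨hy1, hy2⟩, hy⟩ := exists_hasDerivAt_eq_slope NPhi normalDensity
    (lt_add_of_pos_right z h0) (fun x _ => (hasDerivAt_NPhi x).continuousAt.continuousWithinAt)
    (fun x _ => hasDerivAt_NPhi x)
  rw [add_sub_cancel_left, eq_div_iff h0.ne'] at hy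
  have hle : normalDensity (|z| + 1) ≤ normalDensity y := by
    have hyz : |y| ≤ |z| + 1 := abs_le.2
      ⟨by linarith [neg_abs_le z], by linarith [le_abs_self z]⟩
    have := pow_le_pow_left₀ (abs_nonneg y) hyz 2
    rw [sq_abs] at this
    unfold normalDensity
    gcongr
  nlinarith

lemma sum_ite_apply_eq_apply {A : Type*} [Fintype A] [DecidableEq A] {m : ℕ} (hm : 0 < m)
    {a a' : A} (h : a' ≠ a) :
    ∑ c : A → Fin m, (if c a' = c a then (1 : ℝ) else 0) =
      Fintype.card (A → Fin m) / m := by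
  have e := Equiv.funSplitAt a (Fin m)
  have hcard : Fintype.card (A → Fin m) = m * Fintype.card ({j // j ≠ a} → Fin m) := by
    rw [Fintype.card_congr e, Fintype.card_prod, Fintype.card_fin]
  rw [← (Equiv.funSplitAt a (Fin m)).symm.sum_comp, Fintype.sum_prod_type_right]
  have hone : ∀ g : {j // j ≠ a} → Fin m,
      ∑ k : Fin m, (if (Equiv.funSplitAt a (Fin m)).symm (k, g) a' =
        (Equiv.funSplitAt a (Fin m)).symm (k, g) a then (1 : ℝ) else 0) = 1 := fun g => by
    simp [Equiv.funSplitAt, Equiv.piSplitAt, h]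
  have hm' : (m : ℝ) ≠ 0 := by positivity
  simp_rw [hone]
  rw [hcard]
  simp only [Finset.sum_const, Finset.card_univ, nsmul_eq_mul, mul_one, Nat.cast_mul]
  field_simp

/-- One-shot achievability by random binning: source values of conditional probability at least
`1 / r` are decoded correctly, up to a loss of `r / m`. -/
lemma exists_binning_code {A B : Type*} [Fintype A] [DecidableEq A] [Fintype B] [Nonempty A]
    {Q : A → B → ℝ} (hQ : ∀ a b, 0 ≤ Q a b) (hQ1 : ∑ a, ∑ b, Q a b = 1) {m : ℕ} (hm : 0 < m)
    {r : ℝ} (hr : 0 ≤ r) [∀ a b, Decidable (∑ a', Q a' b ≤ r * Q a b)] :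
    ∃ (c : A → Fin m) (D : B → Fin m → A),
      ∑ a, ∑ b, Q a b * (if ∑ a', Q a' b ≤ r * Q a b then 1 else 0) - r / m ≤
        ∑ a, ∑ b, Q a b * (if D b (c a) = a then 1 else 0) := by
  set T : A → B → Prop := fun a b => ∑ a', Q a' b ≤ r * Q a b
  have hcount : ∀ a b, 0 < Q a b → ∑ a', (if T a' b then (1 : ℝ) else 0) ≤ r := by
    intro a b hab
    have hpos : 0 < ∑ a', Q a' b :=
      hab.trans_le (Finset.single_le_sum (fun i _ => hQ i b) (Finset.mem_univ a))
    refine le_of_mul_le_mul_right ?_ hpos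
    rw [Finset.sum_mul, Finset.mul_sum]
    refine Finset.sum_le_sum fun a' _ => ?_
    split_ifs with h
    · rw [one_mul]; exact h
    · rw [zero_mul]; exact mul_nonneg hr (hQ a' b)
  have hdec : ∀ (c : A → Fin m) (b : B) (k : Fin m),
      ∃ a, (∃ a', T a' b ∧ c a' = k) → T a b ∧ c a = k := fun c b k => by
    by_cases h : ∃ a', T a' b ∧ c a' = k
    · exact ⟨h.choose, fun _ => h.choose_spec⟩
    · exact ⟨Classical.arbitrary A, fun h' => absurd h' h⟩
  choose D hD using hdec
  have hpt : ∀ c a b, (if T a b then (1 : ℝ) else 0) - (if D c b (c a) = a then 1 else 0) ≤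
      ∑ a' ∈ Finset.univ.erase a,
        (if T a' b then (1 : ℝ) else 0) * (if c a' = c a then 1 else 0) := by
    intro c a b
    have hnn : ∀ a' ∈ Finset.univ.erase a,
        0 ≤ (if T a' b then (1 : ℝ) else 0) * (if c a' = c a then 1 else 0) := fun a' _ => by
      positivity
    by_cases hDa : D c b (c a) = a
    · have := Finset.sum_nonneg hnn
      rw [if_pos hDa]
      split_ifs <;> linarith
    · by_cases hTa : T a b
      · obtain ⟨h1, h2⟩ := hD c b (c a) ⟨a, hTa, rfl⟩
        refine le_trans ?_ (Finset.single_le_sum hnn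
          (Finset.mem_erase.2 ⟨hDa, Finset.mem_univ _⟩))
        rw [if_pos hTa, if_neg hDa, if_pos h1, if_pos h2]
        norm_num
      · rw [if_neg hTa, if_neg hDa, sub_zero]
        exact Finset.sum_nonneg hnn
  set N : ℝ := ((Fintype.card (A → Fin m) : ℕ) : ℝ) with hN
  have havg : ∑ c : A → Fin m, ∑ a, ∑ b, Q a b *
      ((if T a b then (1 : ℝ) else 0) - (if D c b (c a) = a then 1 else 0)) ≤
      ∑ c : A → Fin m, r / m := by
    rw [Finset.sum_comm]
    have hbound : ∀ a, ∑ c : A → Fin m, ∑ b, Q a b *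
        ((if T a b then (1 : ℝ) else 0) - (if D c b (c a) = a then 1 else 0)) ≤
        ∑ b, Q a b * (r * (N / m)) := fun a => by
      rw [Finset.sum_comm]
      refine Finset.sum_le_sum fun b _ => ?_
      rw [← Finset.mul_sum]
      rcases (hQ a b).eq_or_lt with h0 | h0
      · simp [← h0]
      refine mul_le_mul_of_nonneg_left ?_ (hQ a b)
      calc _ ≤ ∑ c : A → Fin m, ∑ a' ∈ Finset.univ.erase a,
            (if T a' b then (1 : ℝ) else 0) * (if c a' = c a then 1 else 0) :=
            Finset.sum_le_sum fun c _ => hpt c a b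
        _ = ∑ a' ∈ Finset.univ.erase a, (if T a' b then (1 : ℝ) else 0) * (N / m) := by
            rw [Finset.sum_comm]
            refine Finset.sum_congr rfl fun a' ha' => ?_
            rw [← Finset.mul_sum, sum_ite_apply_eq_apply hm (Finset.ne_of_mem_erase ha')]
        _ ≤ ∑ a', (if T a' b then (1 : ℝ) else 0) * (N / m) :=
            Finset.sum_le_sum_of_subset_of_nonneg (Finset.erase_subset _ _)
              fun a' _ _ => by positivity
        _ ≤ r * (N / m) := by
            rw [← Finset.sum_mul]
            exact mul_le_mul_of_nonneg_right (hcount a b h0) (by positivity)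
    refine (Finset.sum_le_sum fun a _ => hbound a).trans ?_
    simp_rw [← Finset.sum_mul, hQ1]
    simp only [Finset.sum_const, Finset.card_univ, nsmul_eq_mul, ← hN]
    exact le_of_eq (by ring)
  have : Nonempty (A → Fin m) := ⟨fun _ => ⟨0, hm⟩⟩
  obtain ⟨c, -, hc⟩ := Finset.exists_le_of_sum_le Finset.univ_nonempty havg
  refine ⟨c, D c, ?_⟩
  simp_rw [mul_sub, Finset.sum_sub_distrib] at hc
  linarith

lemma sum_prod_eq_prod_sum {X Y : Type*} [Fintype X] {P : X → Y → ℝ} {n : ℕ} (ys : Fin n → Y) :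
    ∑ xs : Fin n → X, ∏ i, P (xs i) (ys i) = ∏ i, ∑ x, P x (ys i) := by
  classical
  rw [Finset.prod_univ_sum, Fintype.piFinset_univ]

section conditional

variable {X Y : Type*} [Fintype X] [Fintype Y] {P : X → Y → ℝ}

lemma condH_pos (hP0 : ∀ x y, 0 ≤ P x y) (hV : 0 < condV P) : 0 < condH P := by
  have hterm : ∀ x y, 0 ≤ P x y * Real.log ((∑ x', P x' y) / P x y) := fun x y => by
    rcases (hP0 x y).eq_or_lt with h | h
    · simp [← h]
    · refine mul_nonneg h.le (Real.log_nonneg ?_)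
      rw [one_le_div h]
      exact Finset.single_le_sum (fun i _ => hP0 i y) (Finset.mem_univ x)
  have hnn : 0 ≤ condH P := Finset.sum_nonneg fun x _ => Finset.sum_nonneg fun y _ => hterm x y
  refine hnn.lt_of_ne fun h0 => hV.ne' ?_
  have hz : ∀ x y, P x y * Real.log ((∑ x', P x' y) / P x y) = 0 := fun x y => by
    have h1 := (Finset.sum_eq_zero_iff_of_nonneg
      fun x _ => Finset.sum_nonneg fun y _ => hterm x y).1 h0.symm x (Finset.mem_univ x)
    exact (Finset.sum_eq_zero_iff_of_nonneg fun y _ => hterm x y).1 h1 y (Finset.mem_univ y)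
  unfold condV
  rw [← h0]
  refine Finset.sum_eq_zero fun x _ => Finset.sum_eq_zero fun y _ => ?_
  rw [sub_zero, sq, ← mul_assoc, hz, zero_mul]

lemma iidMean_prod_eq {n : ℕ} (F : (Fin n → X × Y) → ℝ) :
    iidMean (fun a : X × Y => P a.1 a.2) n F =
      ∑ xs : Fin n → X, ∑ ys : Fin n → Y,
        (∏ i, P (xs i) (ys i)) * F (fun i => (xs i, ys i)) := by
  rw [iidMean, ← (Equiv.arrowProdEquivProdArrow (Fin n) (fun _ => X) (fun _ => Y)).symm.sum_comp,
    Fintype.sum_prod_type]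
  rfl

/-- The information spectrum of an i.i.d. source, as a lower bound on the probability that the
conditional probability of the source word is at least `exp (-t)`. -/
lemma iidMean_le_sum_threshold (hP0 : ∀ x y, 0 ≤ P x y) {n : ℕ} (u : ℝ) :
    iidMean (fun a : X × Y => P a.1 a.2) n
      (fun ω => if ∑ i, (Real.log ((∑ x', P x' (ω i).2) / P (ω i).1 (ω i).2) - condH P) ≤ u
        then 1 else 0) ≤
    ∑ xs : Fin n → X, ∑ ys : Fin n → Y, (∏ i, P (xs i) (ys i)) *
      (if ∑ xs' : Fin n → X, ∏ i, P (xs' i) (ys i) ≤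
          Real.exp (n * condH P + u) * ∏ i, P (xs i) (ys i) then 1 else 0) := by
  rw [iidMean_prod_eq]
  refine Finset.sum_le_sum fun xs _ => Finset.sum_le_sum fun ys _ => ?_
  have hnn : 0 ≤ ∏ i, P (xs i) (ys i) := Finset.prod_nonneg fun i _ => hP0 _ _
  rcases hnn.eq_or_lt with h | h
  · simp [← h]
  refine mul_le_mul_of_nonneg_left ?_ hnn
  by_cases hu : ∑ i, (Real.log ((∑ x', P x' (ys i)) / P (xs i) (ys i)) - condH P) ≤ u
  · have hpos : ∀ i, 0 < P (xs i) (ys i) := fun i =>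
      (hP0 _ _).lt_of_ne' (Finset.prod_ne_zero_iff.1 h.ne' i (Finset.mem_univ i))
    have hmarg : ∀ i, 0 < ∑ x', P x' (ys i) := fun i =>
      (hpos i).trans_le (Finset.single_le_sum (fun x _ => hP0 x (ys i)) (Finset.mem_univ (xs i)))
    have hle : ∑ xs' : Fin n → X, ∏ i, P (xs' i) (ys i) ≤
        Real.exp (n * condH P + u) * ∏ i, P (xs i) (ys i) := by
      rw [sum_prod_eq_prod_sum, ← div_le_iff₀ h, ← Finset.prod_div_distrib,
        ← Real.log_le_iff_le_exp (Finset.prod_pos fun i _ => div_pos (hmarg i) (hpos i)),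
        Real.log_prod fun i _ => (div_pos (hmarg i) (hpos i)).ne']
      rw [Finset.sum_sub_distrib] at hu
      simp only [Finset.sum_const, Finset.card_univ, Fintype.card_fin, nsmul_eq_mul] at hu
      linarith
    rw [if_pos hu, if_pos hle]
  · rw [if_neg hu]
    split_ifs <;> norm_num

end conditional

/-- The one-sided Berry–Esseen bound with its error absorbed into the threshold. -/
lemma exists_iidMean_ge {Ω : Type*} [Fintype Ω] {p : Ω → ℝ} (hp : ∀ a, 0 ≤ p a)
    (hp1 : ∑ a, p a = 1) {ξ : Ω → ℝ} (hξ : ∑ a, p a * ξ a = 0) {v : ℝ} (hv : 0 < v)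
    (hξv : ∑ a, p a * ξ a ^ 2 = v) (z : ℝ) :
    ∃ C, 0 ≤ C ∧ ∀ᶠ n : ℕ in atTop, NPhi z + 1 / Real.sqrt n ≤
      iidMean p n (fun ω => if ∑ i, ξ (ω i) ≤ Real.sqrt (n * v) * z + C then 1 else 0) := by
  obtain ⟨κ, hκ, hΦ⟩ := exists_mul_le_NPhi_sub z
  set B : ℝ := 1 + ∑ a, |ξ a| with hB
  have hB0 : 0 < B := by positivity
  have hξB : ∀ a, |ξ a| ≤ B := fun a => by
    have := Finset.single_le_sum (fun i _ => abs_nonneg (ξ i)) (Finset.mem_univ a)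
    linarith
  set β := B / Real.sqrt v with hβ
  have hβ0 : 0 < β := by positivity
  set K := 2 * (13 + 2 * β) * β with hK
  have hK0 : 0 < K := by positivity
  refine ⟨Real.sqrt v * ((K + 1) / κ) + 3 * B, by positivity, ?_⟩
  have hsqrt : Tendsto (fun n : ℕ => Real.sqrt n) atTop atTop :=
    Real.tendsto_sqrt_atTop.comp tendsto_natCast_atTop_atTop
  filter_upwards [hsqrt.eventually_ge_atTop 1, hsqrt.eventually_ge_atTop ((K + 1) / κ),
    eventually_ge_atTop 1] with n hn1 hnK hn
  obtain ⟨k, rfl⟩ := Nat.exists_eq_add_of_le' hn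
  set q := Real.sqrt ((k + 1 : ℕ) : ℝ) with hq
  have hq0 : 0 < q := by linarith
  have hs : Real.sqrt (((k + 1 : ℕ) : ℝ) * v) = q * Real.sqrt v := Real.sqrt_mul (by positivity) v
  set η := (K + 1) / κ / q with hη
  have hη0 : 0 ≤ η := by positivity
  have hη1 : η ≤ 1 := by rw [hη, div_le_one hq0]; exact hnK
  have hδ : B / (q * Real.sqrt v) = β / q := by rw [hβ, div_div, mul_comm q]
  have hbe := NPhi_le_iidMean_add hp hp1 hξ hv hξv hB0 hξB k (z + η)
    (s := q * Real.sqrt v) (δ := β / q) (by rw [← hs]; push_cast; rfl) hδ.symm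
  have hthr : q * Real.sqrt v * (z + η) + 3 * B =
      q * Real.sqrt v * z + (Real.sqrt v * ((K + 1) / κ) + 3 * B) := by
    have : q * η = (K + 1) / κ := by rw [hη]; field_simp
    linear_combination Real.sqrt v * this
  rw [hthr] at hbe
  have hδβ : β / q ≤ β := div_le_self hβ0.le hn1
  have herr : 2 * ((13 + 2 * (β / q)) * (β / q)) ≤ K / q := by
    have : K / q = 2 * ((13 + 2 * β) * (β / q)) := by rw [hK]; ring
    rw [this]
    gcongr
  have hgain : κ * η = K / q + 1 / q := by rw [hη]; field_simp
  have hΦη := hΦ η hη0 hη1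
  rw [hs]
  linarith

/-- second-order achievability for information reconciliation:
if `V(X|Y)_P > 0` and `0 < ε < 1`, there is a constant `C` such that for all
sufficiently large `n` there exists an ε-correct one-way IR code on
`(P_{XY})^{×n}` with `log|M| ≤ n H + √(n V) Φ⁻¹(1-ε) + (1/2) log n + C`. -/
theorem second_order_achievability_IR {X Y : Type*} [Fintype X] [Fintype Y]
    (ε : ℝ) (hε0 : 0 < ε) (hε1 : ε < 1)
    (P : X → Y → ℝ) (hP0 : ∀ x y, 0 ≤ P x y) (hP1 : ∑ x, ∑ y, P x y = 1)
    (hV : 0 < condV P) :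
    ∃ C : ℝ, ∃ N : ℕ, ∀ n ≥ N, ∃ (m : ℕ)
      (e : (Fin n → X) → Fin m → ℝ) (d : (Fin n → Y) → Fin m → (Fin n → X) → ℝ),
      (∀ xs k, 0 ≤ e xs k) ∧ (∀ xs, ∑ k, e xs k = 1) ∧
      (∀ ys k xs, 0 ≤ d ys k xs) ∧ (∀ ys k, ∑ xs, d ys k xs = 1) ∧
      (1 - ε ≤ ∑ xs : Fin n → X, ∑ ys : Fin n → Y, ∑ k : Fin m,
        (∏ i, P (xs i) (ys i)) * e xs k * d ys k xs) ∧
      Real.log m ≤ n * condH P + Real.sqrt (n * condV P) * NPhiInv (1 - ε)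
        + (1/2) * Real.log n + C := by
  classical
  have hH := condH_pos hP0 hV
  set ξ : X × Y → ℝ := fun a => Real.log ((∑ x', P x' a.2) / P a.1 a.2) - condH P with hξdef
  set p : X × Y → ℝ := fun a => P a.1 a.2 with hp
  have hp1 : ∑ a, p a = 1 := by rw [Fintype.sum_prod_type]; exact hP1
  have hξ : ∑ a, p a * ξ a = 0 := by
    simp only [hξdef, mul_sub, Finset.sum_sub_distrib, ← Finset.sum_mul, hp1]
    rw [Fintype.sum_prod_type, one_mul]
    exact sub_self _
  have hξv : ∑ a, p a * ξ a ^ 2 = condV P := by rw [Fintype.sum_prod_type]; rfl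
  set z := NPhiInv (1 - ε) with hz
  have hΦz : NPhi z = 1 - ε := NPhi_NPhiInv (by linarith) (by linarith)
  obtain ⟨C, hC, hev⟩ := exists_iidMean_ge (p := p) (fun a => hP0 a.1 a.2) hp1 hξ hV hξv z
  have hX : Nonempty X := by
    by_contra h
    rw [not_nonempty_iff] at h
    simp at hP1
  have hsqrt : Tendsto (fun n : ℕ => Real.sqrt n) atTop atTop :=
    Real.tendsto_sqrt_atTop.comp tendsto_natCast_atTop_atTop
  obtain ⟨N, hN⟩ := eventually_atTop.1 (hev.and ((hsqrt.eventually_ge_atTop 1).and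
    (hsqrt.eventually_ge_atTop (Real.sqrt (condV P) * |z| / condH P))))
  refine ⟨C + Real.log 2, N, fun n hn => ?_⟩
  obtain ⟨hbe, hn1, hnz⟩ := hN n hn
  set t := n * condH P + (Real.sqrt (n * condV P) * z + C) with ht
  have ht0 : 0 ≤ t := by
    rw [div_le_iff₀ hH] at hnz
    have h1 : Real.sqrt (n * condV P) = Real.sqrt n * Real.sqrt (condV P) :=
      Real.sqrt_mul (by positivity) _
    have h2 : Real.sqrt n * Real.sqrt n = n := Real.mul_self_sqrt (by positivity)
    have h3 := mul_le_mul_of_nonneg_left hnz (Real.sqrt_nonneg n)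
    have h4 : -(Real.sqrt (n * condV P) * |z|) ≤ Real.sqrt (n * condV P) * z := by
      rw [← mul_neg]
      exact mul_le_mul_of_nonneg_left (neg_abs_le z) (Real.sqrt_nonneg _)
    rw [h1] at h4
    rw [ht, h1]
    nlinarith
  have hq0 : 0 < Real.sqrt n := by linarith
  have hprod : 1 ≤ Real.exp t * Real.sqrt n := one_le_mul_of_one_le_of_one_le
    (Real.one_le_exp ht0) hn1
  set m := ⌈Real.exp t * Real.sqrt n⌉₊ with hm
  have hm0 : 0 < m := Nat.ceil_pos.2 (by positivity)
  have hm0' : (0 : ℝ) < m := by exact_mod_cast hm0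
  have hQ : ∀ (xs : Fin n → X) (ys : Fin n → Y), 0 ≤ ∏ i, P (xs i) (ys i) := fun xs ys =>
    Finset.prod_nonneg fun i _ => hP0 _ _
  have hQ1 : ∑ xs : Fin n → X, ∑ ys : Fin n → Y, ∏ i, P (xs i) (ys i) = 1 := by
    have h1 := iidMean_const (n := n) hp1 1
    rw [iidMean_prod_eq] at h1
    simpa using h1
  obtain ⟨c, D, hcD⟩ := exists_binning_code hQ hQ1 hm0 (Real.exp_pos t).le
  refine ⟨m, fun xs k => if c xs = k then 1 else 0, fun ys k xs => if D ys k = xs then 1 else 0,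
    fun _ _ => by positivity, fun _ => by simp, fun _ _ _ => by positivity, fun _ _ => by simp,
    ?_, ?_⟩
  · have hloss : Real.exp t / m ≤ 1 / Real.sqrt n := by
      rw [div_le_div_iff₀ hm0' hq0, one_mul]
      exact Nat.le_ceil _
    have hthr := iidMean_le_sum_threshold hP0 (n := n) (Real.sqrt (n * condV P) * z + C)
    have hcode : ∀ (xs : Fin n → X) (ys : Fin n → Y), ∑ k : Fin m,
        (∏ i, P (xs i) (ys i)) * (if c xs = k then (1 : ℝ) else 0) *
          (if D ys k = xs then 1 else 0) =
        (∏ i, P (xs i) (ys i)) * (if D ys (c xs) = xs then 1 else 0) := fun xs ys => by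
      rw [Finset.sum_eq_single (c xs) (fun k _ hk => by rw [if_neg hk.symm]; ring) (by simp),
        if_pos rfl, mul_one]
    simp_rw [hcode]
    rw [hΦz] at hbe
    refine le_trans ?_ hcD
    have hge := hbe.trans hthr
    linarith
  · have hm2 : (m : ℝ) ≤ 2 * (Real.exp t * Real.sqrt n) := by
      have := Nat.ceil_lt_add_one (zero_le_one.trans hprod)
      linarith
    have hlog := Real.log_le_log hm0' hm2
    rw [Real.log_mul two_ne_zero (by positivity), Real.log_mul (Real.exp_pos t).ne' hq0.ne',
      Real.log_exp, Real.log_sqrt (by positivity)] at hlog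
    linarith
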